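/- Discrete DWR error representation on an enriched space: Let V be a real Banach space, W ⊆ V a closed subspace, and let A : V → (V →L[ℝ] ℝ) and J : V → ℝ be three times continuously Fréchet differentiable. Let U ∈ V (with J(U) defined), let U₂ ∈ V satisfy A(U₂)(ψ) = 0 for all ψ ∈ W, and let Z₂ ∈ W satisfy (A′(U₂)ψ)(Z₂) = J′(U₂)(ψ) for all ψ ∈ W. Then for all Ũ, Z̃ ∈ V with e₂ := U₂ − Ũ ∈ W and f₂ := Z₂ − Z̃ ∈ W, one has J(U) − J(Ũ) = (J(U) − J(U₂)) + (1/2)·( −A(Ũ)(f₂) + J′(Ũ)(e₂) − (A′(Ũ)e₂)(Z̃) ) − A(Ũ)(Z̃) + R₂, where R₂ = (1/2)·∫₀¹ s·(s−1)·[ J‴(Ũ+s·e₂)(e₂,e₂,e₂) − (A‴(Ũ+s·e₂)(e₂,e₂,e₂))(Z̃+s·f₂) − 3·(A″(Ũ+s·e₂)(e₂,e₂))(f₂) ] ds. -/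

import Mathlib

/-- Derivative of the diagonal of an iterated derivative along a line. -/
theorem hasDerivAt_iteratedFDeriv_line {E F : Type*} [NormedAddCommGroup E] [NormedSpace ℝ E]
    [NormedAddCommGroup F] [NormedSpace ℝ F] {f : E → F} {n : ℕ} (hf : ContDiff ℝ (n + 1 : ℕ) f)
    (x e : E) (s : ℝ) :
    HasDerivAt (fun t : ℝ => iteratedFDeriv ℝ n f (x + t • e) (fun _ => e))
      (iteratedFDeriv ℝ (n + 1) f (x + s • e) (fun _ => e)) s := by
  have hline : HasDerivAt (fun t : ℝ => x + t • e) e s := by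
    simpa using ((hasDerivAt_id s).smul_const e).const_add x
  have hdiff : Differentiable ℝ (iteratedFDeriv ℝ n f) :=
    hf.differentiable_iteratedFDeriv (by exact_mod_cast Nat.lt_succ_self n)
  have hcomp := (hdiff (x + s • e)).hasFDerivAt.comp_hasDerivAt s hline
  exact (ContinuousMultilinearMap.apply ℝ (fun _ : Fin n => E) F
    (fun _ => e)).hasFDerivAt.comp_hasDerivAt s hcomp

/-- Trapezoidal rule with the integral form of the remainder. -/
theorem sub_eq_trapezoid_add_integral {g₀ g₁ g₂ g₃ : ℝ → ℝ}
    (h₀ : ∀ s, HasDerivAt g₀ (g₁ s) s) (h₁ : ∀ s, HasDerivAt g₁ (g₂ s) s)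
    (h₂ : ∀ s, HasDerivAt g₂ (g₃ s) s) (h₃ : Continuous g₃) :
    g₀ 1 - g₀ 0 = (1 / 2) * (g₁ 0 + g₁ 1) + (1 / 2) * ∫ s in (0 : ℝ)..1, s * (s - 1) * g₃ s := by
  have hprim : ∀ s : ℝ, HasDerivAt
      (fun s => s * (s - 1) * g₂ s - (2 * s - 1) * g₁ s + 2 * g₀ s) (s * (s - 1) * g₃ s) s := by
    intro s
    have hid := hasDerivAt_id' s
    exact ((((hid.mul (hid.sub_const 1)).mul (h₂ s)).sub
      (((hid.const_mul 2).sub_const 1).mul (h₁ s))).add ((h₀ s).const_mul 2)).congr_deriv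
        (by simp only [Pi.mul_apply]; ring)
  rw [intervalIntegral.integral_eq_sub_of_hasDerivAt (fun s _ => hprim s)
    (by apply Continuous.intervalIntegrable; fun_prop)]
  ring

/-- Discrete DWR error representation on an enriched space `W ⊆ V`. -/
theorem dwr_discrete_error_representation
    {V : Type*} [NormedAddCommGroup V] [NormedSpace ℝ V] [CompleteSpace V]
    (W : Submodule ℝ V) (hW : IsClosed (W : Set V))
    (A : V → (V →L[ℝ] ℝ)) (J : V → ℝ)
    (hA : ContDiff ℝ 3 A) (hJ : ContDiff ℝ 3 J)
    (U U₂ Z₂ : V) (hZ₂ : Z₂ ∈ W)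
    (hU₂ : ∀ ψ ∈ W, A U₂ ψ = 0)
    (hadj : ∀ ψ ∈ W, (fderiv ℝ A U₂ ψ) Z₂ = fderiv ℝ J U₂ ψ) :
    ∀ Ut Zt : V, U₂ - Ut ∈ W → Z₂ - Zt ∈ W →
      J U - J Ut =
        (J U - J U₂)
          + (1 / 2) * (-(A Ut (Z₂ - Zt)) + fderiv ℝ J Ut (U₂ - Ut)
              - (fderiv ℝ A Ut (U₂ - Ut)) Zt)
          - A Ut Zt
          + (1 / 2) * ∫ s in (0:ℝ)..1, s * (s - 1) *
              (iteratedFDeriv ℝ 3 J (Ut + s • (U₂ - Ut)) ![U₂ - Ut, U₂ - Ut, U₂ - Ut]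
                - (iteratedFDeriv ℝ 3 A (Ut + s • (U₂ - Ut)) ![U₂ - Ut, U₂ - Ut, U₂ - Ut])
                    (Zt + s • (Z₂ - Zt))
                - 3 * (iteratedFDeriv ℝ 2 A (Ut + s • (U₂ - Ut)) ![U₂ - Ut, U₂ - Ut])
                    (Z₂ - Zt)) := by
  intro Ut Zt he hf
  set e := U₂ - Ut with he_def
  set f := Z₂ - Zt with hf_def
  have hU : Ut + e = U₂ := by simp [he_def]
  have hZ : Zt + f = Z₂ := by simp [hf_def]
  have hz : ∀ s : ℝ, HasDerivAt (fun t : ℝ => Zt + t • f) f s := fun s => by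
    simpa using ((hasDerivAt_id s).smul_const f).const_add Zt
  let j (n : ℕ) (s : ℝ) : ℝ := iteratedFDeriv ℝ n J (Ut + s • e) (fun _ => e)
  let a (n : ℕ) (s : ℝ) : V →L[ℝ] ℝ := iteratedFDeriv ℝ n A (Ut + s • e) (fun _ => e)
  have hj : ∀ n < 3, ∀ s, HasDerivAt (j n) (j (n + 1) s) s := fun n hn s =>
    hasDerivAt_iteratedFDeriv_line (hJ.of_le (by exact_mod_cast hn)) Ut e s
  have ha : ∀ n < 3, ∀ s, HasDerivAt (a n) (a (n + 1) s) s := fun n hn s =>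
    hasDerivAt_iteratedFDeriv_line (hA.of_le (by exact_mod_cast hn)) Ut e s
  have haz : ∀ n < 3, ∀ s, HasDerivAt (fun t => a n t (Zt + t • f))
      (a (n + 1) s (Zt + s • f) + a n s f) s := fun n hn s => (ha n hn s).clm_apply (hz s)
  have haf : ∀ n < 3, ∀ s, HasDerivAt (fun t => a n t f) (a (n + 1) s f) s := fun n hn s => by
    simpa using (ha n hn s).clm_apply (hasDerivAt_const s f)
  have hj_cont : Continuous (j 3) := by
    have := hJ.continuous_iteratedFDeriv (m := 3) le_rfl
    fun_prop
  have ha_cont : ∀ n ≤ 3, Continuous (a n) := fun n hn => by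
    have := hA.continuous_iteratedFDeriv (m := n) (by exact_mod_cast hn)
    fun_prop
  have ha₂ := ha_cont 2 (by norm_num)
  have ha₃ := ha_cont 3 le_rfl
  have key := sub_eq_trapezoid_add_integral
    (g₀ := fun s => j 0 s - a 0 s (Zt + s • f))
    (g₁ := fun s => j 1 s - a 1 s (Zt + s • f) - a 0 s f)
    (g₂ := fun s => j 2 s - a 2 s (Zt + s • f) - 2 * a 1 s f)
    (g₃ := fun s => j 3 s - a 3 s (Zt + s • f) - 3 * a 2 s f)
    (fun s => ((hj 0 (by norm_num) s).sub (haz 0 (by norm_num) s)).congr_deriv (by ring))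
    (fun s => (((hj 1 (by norm_num) s).sub (haz 1 (by norm_num) s)).sub
      (haf 0 (by norm_num) s)).congr_deriv (by ring))
    (fun s => (((hj 2 (by norm_num) s).sub (haz 2 (by norm_num) s)).sub
      ((haf 1 (by norm_num) s).const_mul 2)).congr_deriv (by ring))
    (by fun_prop)
  have h2 : (![e, e] : Fin 2 → V) = fun _ => e := by
    ext i; fin_cases i <;> rfl
  have h3 : (![e, e, e] : Fin 3 → V) = fun _ => e := by
    ext i; fin_cases i <;> rfl
  rw [h3, h2]
  simp only [j, a, iteratedFDeriv_zero_apply, iteratedFDeriv_one_apply, zero_smul, one_smul,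
    add_zero, hU, hZ, hU₂ _ hZ₂, hU₂ _ hf, hadj _ he] at key
  linarith
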